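/- arXiv:2003.04122 — 4 statements merged into one kernel-verified Lean document; each statement's English description precedes it below -/
import Mathlib

section
/- There is an absolute constant C > 0 such that for every positive integer N, the number of six-tuples (x₁, x₂, x₃, x₄, x₅, x₆) ∈ [N]⁶ satisfying x₁² + x₂² + x₃² = x₄² + x₅² + x₆² is at most C N⁴. -/
open Finset in
lemma aux_spaced (M r : ℕ) (hr : 0 < r) (hrM : r ≤ M) (S : Finset ℤ)
    (hS : S ⊆ Icc (-(M : ℤ)) M) (hd : ∀ x ∈ S, ∀ y ∈ S, (r : ℤ) ∣ x - y) :
    S.card * r ≤ 3 * M := by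
  have hr' : (0 : ℤ) < r := by exact_mod_cast hr
  have h1 : S.card ≤ (Icc (0 : ℤ) ((2 * M / r : ℕ) : ℤ)).card := by
    apply card_le_card_of_injOn (fun x : ℤ => (x + (M : ℤ)) / (r : ℤ))
    · intro x hx
      have hx' := mem_Icc.1 (hS hx)
      simp only [coe_Icc, Set.mem_Icc]
      constructor
      · apply Int.ediv_nonneg <;> omega
      · push_cast
        apply Int.ediv_le_ediv hr'
        omega
    · intro x hx y hy hxy
      simp only at hxy
      have h := hd x hx y hy
      have hm : (x + M) % r = (y + M) % r := by
        apply Int.emod_eq_emod_iff_emod_sub_eq_zero.2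
        apply Int.emod_eq_zero_of_dvd
        simpa using h
      have e1 := Int.mul_ediv_add_emod (x + M) r
      have e2 := Int.mul_ediv_add_emod (y + M) r
      rw [hxy, hm] at e1
      omega
  have h2 : S.card ≤ 2 * M / r + 1 := by
    rw [Int.card_Icc] at h1
    generalize 2 * M / r = q at h1 ⊢
    omega
  calc S.card * r ≤ (2 * M / r + 1) * r := Nat.mul_le_mul_right _ h2
    _ = 2 * M / r * r + r := by ring
    _ ≤ 2 * M + M := add_le_add (Nat.div_mul_le_self _ _) hrM
    _ = 3 * M := by ring

open Finset in
noncomputable def solSet (M : ℕ) (a b c : ℤ) : Finset (ℤ × ℤ × ℤ) :=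
  (Icc (-(M : ℤ)) M ×ˢ Icc (-(M : ℤ)) M ×ˢ Icc (-(M : ℤ)) M).filter
    fun p => a * p.1 + b * p.2.1 + c * p.2.2 = 0

open Finset in
lemma aux_sol (M : ℕ) (a b c : ℤ) (hc : c ≠ 0) (hcM : c.natAbs ≤ M) :
    (solSet M a b c).card * c.natAbs ≤ 9 * M ^ 2 * Int.gcd a (Int.gcd b c) := by
  set D := Int.gcd a (Int.gcd b c) with hD
  have hDbc : D ∣ Int.gcd b c := by
    have := Int.gcd_dvd_right a (Int.gcd b c : ℤ)
    exact_mod_cast this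
  have hg0 : 0 < Int.gcd b c := Int.gcd_pos_of_ne_zero_right _ hc
  have hD0 : 0 < D := Nat.pos_of_dvd_of_pos hDbc hg0
  obtain ⟨g, hg⟩ := hDbc
  have hgpos : 0 < g := by
    rcases Nat.eq_zero_or_pos g with h | h
    · simp [h] at hg; omega
    · exact h
  obtain ⟨a', ha'⟩ : (D : ℤ) ∣ a := Int.gcd_dvd_left a _
  obtain ⟨b', hb'⟩ : ((Int.gcd b c : ℕ) : ℤ) ∣ b := Int.gcd_dvd_left b c
  obtain ⟨m', hm'⟩ : ((Int.gcd b c : ℕ) : ℤ) ∣ c := Int.gcd_dvd_right b c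
  have hcop1 : IsCoprime (g : ℤ) a' := by
    rw [Int.isCoprime_iff_gcd_eq_one]
    have h : D * Int.gcd (g:ℤ) a' = D * 1 := by
      have h2 : Int.gcd ((D:ℤ) * g) (D * a') = D * Int.gcd (g:ℤ) a' := by
        rw [Int.gcd_mul_left]; simp
      rw [← h2, ← ha', Int.gcd_comm, mul_one]
      conv_rhs => rw [hD, hg]
      push_cast
      rfl
    exact Nat.eq_of_mul_eq_mul_left hD0 h
  have hcop2 : IsCoprime m' b' := by
    rw [Int.isCoprime_iff_gcd_eq_one]
    have h : Int.gcd b c * Int.gcd m' b' = Int.gcd b c * 1 := by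
      have h2 : Int.gcd ((Int.gcd b c : ℤ) * m') ((Int.gcd b c : ℤ) * b')
          = Int.gcd b c * Int.gcd m' b' := by
        rw [Int.gcd_mul_left]; simp
      rw [← h2, ← hm', ← hb', Int.gcd_comm, mul_one]
    exact Nat.eq_of_mul_eq_mul_left hg0 h
  have hDz : (D : ℤ) ≠ 0 := by exact_mod_cast hD0.ne'
  have hgz : (g : ℤ) ≠ 0 := by exact_mod_cast hgpos.ne'
  rw [hg] at hb' hm'
  push_cast at hb' hm'
  have hm0 : m' ≠ 0 := by rintro rfl; simp at hm'; exact hc hm'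
  have hmpos : 0 < m'.natAbs := Int.natAbs_pos.2 hm0
  have hcabs : c.natAbs = D * g * m'.natAbs := by
    rw [hm', Int.natAbs_mul, Int.natAbs_mul]; simp
  have heq : ∀ x y z : ℤ, a * x + b * y + c * z = 0 → a' * x + g * (b' * y + m' * z) = 0 := by
    intro x y z h
    have : (D : ℤ) * (a' * x + g * (b' * y + m' * z)) = 0 := by
      rw [← h, ha', hb', hm']; ring
    exact (mul_eq_zero.1 this).resolve_left hDz
  have hmem : ∀ p ∈ solSet M a b c, (p.1 ∈ Icc (-(M:ℤ)) M ∧ p.2.1 ∈ Icc (-(M:ℤ)) M) ∧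
      a' * p.1 + g * (b' * p.2.1 + m' * p.2.2) = 0 := by
    intro p hp
    simp only [solSet, mem_filter, mem_product] at hp
    exact ⟨⟨hp.1.1, hp.1.2.1⟩, heq _ _ _ hp.2⟩
  have hgM : g ≤ M := by
    refine le_trans (Nat.le_of_dvd (by omega) ?_) hcM
    rw [hcabs]; exact ⟨D * m'.natAbs, by ring⟩
  have hmM : m'.natAbs ≤ M := by
    refine le_trans (Nat.le_of_dvd (by omega) ?_) hcM
    rw [hcabs]; exact ⟨D * g, by ring⟩
  set X := (solSet M a b c).image (fun p => p.1) with hX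
  have hXc : X.card * g ≤ 3 * M := by
    have hXd : ∀ x ∈ X, (g : ℤ) ∣ x := by
      intro x hx
      obtain ⟨p, hp, rfl⟩ := mem_image.1 hx
      have h := (hmem p hp).2
      apply hcop1.dvd_of_dvd_mul_left
      exact ⟨-(b' * p.2.1 + m' * p.2.2), by linarith⟩
    apply aux_spaced M g hgpos hgM
    · intro x hx
      obtain ⟨p, hp, rfl⟩ := mem_image.1 hx
      exact (hmem p hp).1.1
    · intro x hx y hy
      exact dvd_sub (hXd x hx) (hXd y hy)
  have hfib : ∀ x ∈ X, ((solSet M a b c).filter fun p => p.1 = x).card * m'.natAbs ≤ 3 * M := by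
    intro x hx
    have hcard : ((solSet M a b c).filter fun p => p.1 = x).card =
        (((solSet M a b c).filter fun p => p.1 = x).image fun p => p.2.1).card := by
      rw [card_image_of_injOn]
      rintro ⟨x1, y1, z1⟩ h1 ⟨x2, y2, z2⟩ h2 h12
      simp only [coe_filter, Set.mem_ofPred_eq] at h1 h2 h12
      obtain ⟨h1, rfl⟩ := h1
      obtain ⟨h2, rfl⟩ := h2
      subst h12
      have e1 := (hmem _ h1).2
      have e2 := (hmem _ h2).2
      simp only at e1 e2
      have : (g * m' : ℤ) * z1 = (g * m') * z2 := by linear_combination e1 - e2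
      have := mul_left_cancel₀ (mul_ne_zero hgz hm0) this
      rw [this]
    rw [hcard]
    apply aux_spaced M _ hmpos hmM
    · intro y hy
      obtain ⟨p, hp, rfl⟩ := mem_image.1 hy
      exact (hmem p (mem_filter.1 hp).1).1.2
    · intro y hy w hw
      obtain ⟨p, hp, rfl⟩ := mem_image.1 hy
      obtain ⟨q, hq, rfl⟩ := mem_image.1 hw
      rw [mem_filter] at hp hq
      have e1 := (hmem _ hp.1).2
      have e2 := (hmem _ hq.1).2
      rw [hp.2] at e1
      rw [hq.2] at e2
      rw [Int.natAbs_dvd]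
      apply hcop2.dvd_of_dvd_mul_left
      refine ⟨q.2.2 - p.2.2, ?_⟩
      apply mul_left_cancel₀ hgz
      linear_combination e1 - e2
  have hsum : (solSet M a b c).card * m'.natAbs ≤ X.card * (3 * M) := by
    rw [card_eq_sum_card_image (fun p => p.1) (solSet M a b c), sum_mul, ← smul_eq_mul, ← sum_const]
    exact sum_le_sum hfib
  calc (solSet M a b c).card * c.natAbs
      = ((solSet M a b c).card * m'.natAbs) * g * D := by rw [hcabs]; ring
    _ ≤ X.card * (3 * M) * g * D := by gcongr
    _ = (X.card * g) * (3 * M * D) := by ring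
    _ ≤ (3 * M) * (3 * M * D) := by gcongr
    _ = _ := by ring

open Finset in
lemma aux_mult (k d : ℕ) (hk : 0 < k) (hd : d ∣ k) :
    ((Icc (-(k : ℤ)) k).filter fun a => (d : ℤ) ∣ a).card * d ≤ 3 * k := by
  apply aux_spaced k d (Nat.pos_of_dvd_of_pos hd hk) (Nat.le_of_dvd hk hd)
  · exact filter_subset _ _
  · intro x hx y hy
    exact dvd_sub (mem_filter.1 hx).2 (mem_filter.1 hy).2

open Finset in
lemma aux_gcd (c : ℤ) (hc : c ≠ 0) :
    ∑ ab ∈ Icc (-(c.natAbs : ℤ)) c.natAbs ×ˢ Icc (-(c.natAbs : ℤ)) c.natAbs,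
      Int.gcd ab.1 (Int.gcd ab.2 c) ≤ 9 * c.natAbs * ∑ d ∈ c.natAbs.divisors, d := by
  set k := c.natAbs with hk
  have hk0 : 0 < k := Int.natAbs_pos.2 hc
  calc _ ≤ ∑ ab ∈ Icc (-(k : ℤ)) k ×ˢ Icc (-(k : ℤ)) k, ∑ d ∈ k.divisors,
        (if (d : ℤ) ∣ ab.1 ∧ (d : ℤ) ∣ ab.2 then d else 0) := by
        apply sum_le_sum
        rintro ⟨a, b⟩ -
        set D := Int.gcd a (Int.gcd b c)
        have h1 : (D : ℤ) ∣ a := Int.gcd_dvd_left _ _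
        have h2 : (D : ℤ) ∣ Int.gcd b c := Int.gcd_dvd_right _ _
        have h3 : (D : ℤ) ∣ b := h2.trans (Int.gcd_dvd_left _ _)
        have h4 : (D : ℤ) ∣ c := h2.trans (Int.gcd_dvd_right _ _)
        have h5 : D ∈ k.divisors := by
          rw [Nat.mem_divisors]
          exact ⟨Int.natCast_dvd.1 h4, hk0.ne'⟩
        refine le_trans ?_ (single_le_sum (f := fun d : ℕ =>
          if (d : ℤ) ∣ a ∧ (d : ℤ) ∣ b then d else 0) (fun _ _ => Nat.zero_le _) h5)
        simp [h1, h3]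
    _ = ∑ d ∈ k.divisors, ((Icc (-(k : ℤ)) k).filter fun a => (d : ℤ) ∣ a).card ^ 2 * d := by
        rw [sum_comm]
        apply sum_congr rfl
        intro d _
        rw [← sum_filter, sum_const, smul_eq_mul, filter_product, card_product, sq]
    _ ≤ ∑ d ∈ k.divisors, 9 * k * (k / d) := by
        apply sum_le_sum
        intro d hd
        have hd' := Nat.dvd_of_mem_divisors hd
        have h := aux_mult k d hk0 hd'
        have hd0 := Nat.pos_of_mem_divisors hd
        apply Nat.le_of_mul_le_mul_right _ hd0
        calc _ = (((Icc (-(k : ℤ)) k).filter fun a => (d : ℤ) ∣ a).card * d) ^ 2 := by ring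
          _ ≤ (3 * k) ^ 2 := by gcongr
          _ = 9 * k * (k / d * d) := by rw [Nat.div_mul_cancel hd']; ring
          _ = _ := by ring
    _ = _ := by rw [← mul_sum, Nat.sum_div_divisors k (fun d => d)]

open Finset in
lemma aux_sigma (M : ℕ) : ∑ k ∈ Icc 1 M, ∑ d ∈ k.divisors, d ≤ M ^ 2 := by
  calc _ = ∑ k ∈ Icc 1 M, ∑ d ∈ Icc 1 M, (if d ∣ k then d else 0) := by
        apply sum_congr rfl
        intro k hk
        rw [mem_Icc] at hk
        rw [← sum_filter]
        apply sum_congr _ (fun _ _ => rfl)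
        ext d
        simp only [Nat.mem_divisors, mem_filter, mem_Icc]
        constructor
        · rintro ⟨h, h0⟩
          exact ⟨⟨Nat.pos_of_dvd_of_pos h hk.1, (Nat.le_of_dvd hk.1 h).trans hk.2⟩, h⟩
        · rintro ⟨_, h⟩
          exact ⟨h, by omega⟩
    _ = ∑ d ∈ Icc 1 M, M / d * d := by
        rw [sum_comm]
        apply sum_congr rfl
        intro d _
        rw [← sum_filter, sum_const, smul_eq_mul]
        congr 1
        exact Nat.Ioc_filter_dvd_card_eq_div M d
    _ ≤ ∑ d ∈ Icc 1 M, M := sum_le_sum fun d _ => Nat.div_mul_le_self _ _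
    _ = M ^ 2 := by simp [sq]

open Finset in
noncomputable def bigSet (M : ℕ) : Finset (Σ _ : ℤ, Σ _ : ℤ × ℤ, ℤ × ℤ × ℤ) :=
  ((Icc (-(M : ℤ)) M).filter fun c => c ≠ 0).sigma fun c =>
    (Icc (-(c.natAbs : ℤ)) c.natAbs ×ˢ Icc (-(c.natAbs : ℤ)) c.natAbs).sigma fun ab =>
      solSet M ab.1 ab.2 c

open Finset in
lemma aux_big (M : ℕ) : (bigSet M).card ≤ 162 * M ^ 4 := by
  simp only [bigSet, card_sigma]
  calc _ ≤ ∑ c ∈ (Icc (-(M : ℤ)) M).filter fun c => c ≠ 0,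
        81 * M ^ 2 * ∑ d ∈ c.natAbs.divisors, d := by
        apply sum_le_sum
        intro c hc
        rw [mem_filter, mem_Icc] at hc
        have hk0 : 0 < c.natAbs := Int.natAbs_pos.2 hc.2
        apply Nat.le_of_mul_le_mul_right _ hk0
        rw [sum_mul]
        calc _ ≤ ∑ ab ∈ Icc (-(c.natAbs : ℤ)) c.natAbs ×ˢ Icc (-(c.natAbs : ℤ)) c.natAbs,
              9 * M ^ 2 * Int.gcd ab.1 (Int.gcd ab.2 c) :=
              sum_le_sum fun ab _ => aux_sol M ab.1 ab.2 c hc.2 (by omega)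
          _ = 9 * M ^ 2 * ∑ ab ∈ Icc (-(c.natAbs : ℤ)) c.natAbs ×ˢ Icc (-(c.natAbs : ℤ)) c.natAbs,
              Int.gcd ab.1 (Int.gcd ab.2 c) := by rw [mul_sum]
          _ ≤ 9 * M ^ 2 * (9 * c.natAbs * ∑ d ∈ c.natAbs.divisors, d) := by
              gcongr
              exact aux_gcd c hc.2
          _ = _ := by ring
    _ = 81 * M ^ 2 * ∑ c ∈ (Icc (-(M : ℤ)) M).filter fun c => c ≠ 0,
        ∑ d ∈ c.natAbs.divisors, d := by rw [mul_sum]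
    _ ≤ 81 * M ^ 2 * (2 * ∑ k ∈ Icc 1 M, ∑ d ∈ k.divisors, d) := by
        gcongr
        rw [← sum_fiberwise_of_maps_to (g := Int.natAbs) (t := Icc 1 M), mul_sum]
        · apply sum_le_sum
          intro k hk
          rw [sum_congr rfl (g := fun _ => ∑ d ∈ k.divisors, d)]
          · rw [sum_const, smul_eq_mul]
            gcongr
            refine (card_le_card (t := {(k : ℤ), -(k : ℤ)}) ?_).trans card_le_two
            intro x hx
            simp only [mem_filter, mem_insert, mem_singleton] at hx ⊢
            omega
          · intro x hx
            rw [(mem_filter.1 hx).2]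
        · intro x hx
          simp only [mem_filter, mem_Icc] at hx ⊢
          omega
    _ ≤ 81 * M ^ 2 * (2 * M ^ 2) := by gcongr; exact aux_sigma M
    _ = _ := by ring

open Finset in
lemma aux_part (N : ℕ) (i j k : Fin 3) (hijk : ∀ l : Fin 3, l = i ∨ l = j ∨ l = k)
    (F : Finset (Fin 3 → ℤ × ℤ))
    (hF : ∀ f ∈ F, (∀ l, f l ∈ Icc (1 : ℤ) N ×ˢ Icc (1 : ℤ) N) ∧
      ((f i).1 ^ 2 - (f i).2 ^ 2) + ((f j).1 ^ 2 - (f j).2 ^ 2) +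
        ((f k).1 ^ 2 - (f k).2 ^ 2) = 0 ∧
      (f k).1 - (f k).2 ≠ 0 ∧
      ((f i).1 - (f i).2).natAbs ≤ ((f k).1 - (f k).2).natAbs ∧
      ((f j).1 - (f j).2).natAbs ≤ ((f k).1 - (f k).2).natAbs) :
    F.card ≤ 162 * (2 * N) ^ 4 := by
  refine le_trans ?_ (aux_big (2 * N))
  apply card_le_card_of_injOn (fun f => ⟨(f k).1 - (f k).2,
    ⟨((f i).1 - (f i).2, (f j).1 - (f j).2),
      ((f i).1 + (f i).2, (f j).1 + (f j).2, (f k).1 + (f k).2)⟩⟩)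
  · intro f hf
    obtain ⟨hb, he, h0, h1, h2⟩ := hF f hf
    have bi := hb i
    have bj := hb j
    have bk := hb k
    simp only [mem_product, mem_Icc] at bi bj bk
    simp only [bigSet, solSet, mem_coe, mem_sigma, mem_filter, mem_product, mem_Icc]
    refine ⟨⟨by omega, h0⟩, ⟨by omega, by omega⟩, ⟨by omega, by omega, by omega⟩, ?_⟩
    linear_combination he
  · intro f _ g _ hfg
    simp only [Sigma.mk.injEq, heq_eq_eq, Prod.mk.injEq] at hfg
    funext l
    rcases hijk l with rfl | rfl | rfl <;> ext <;> omega

open Finset in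
/-- **Counting solutions to `x₁² + x₂² + x₃² = x₄² + x₅² + x₆²` in `[N]⁶`.** -/
theorem count_sum_three_squares :
    ∃ C : ℝ, 0 < C ∧
      ∀ N : ℕ, 0 < N →
        (((Fintype.piFinset fun _ : Fin 6 => Finset.Icc (1 : ℤ) (N : ℤ)).filter
            fun x : Fin 6 → ℤ =>
              x 0 ^ 2 + x 1 ^ 2 + x 2 ^ 2 = x 3 ^ 2 + x 4 ^ 2 + x 5 ^ 2).card : ℝ) ≤
          C * (N : ℝ) ^ 4 := by
  refine ⟨10000, by norm_num, ?_⟩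
  intro N hN
  set S := (Fintype.piFinset fun _ : Fin 6 => Finset.Icc (1 : ℤ) (N : ℤ)).filter
            fun x : Fin 6 → ℤ =>
              x 0 ^ 2 + x 1 ^ 2 + x 2 ^ 2 = x 3 ^ 2 + x 4 ^ 2 + x 5 ^ 2 with hS
  set G : Finset (Fin 3 → ℤ × ℤ) := (Fintype.piFinset fun _ : Fin 3 =>
    Icc (1 : ℤ) (N : ℤ) ×ˢ Icc (1 : ℤ) (N : ℤ)).filter fun f =>
      ((f 0).1 ^ 2 - (f 0).2 ^ 2) + ((f 1).1 ^ 2 - (f 1).2 ^ 2) +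
        ((f 2).1 ^ 2 - (f 2).2 ^ 2) = 0 with hG
  have hGm : ∀ f ∈ G, (∀ l, f l ∈ Icc (1 : ℤ) N ×ˢ Icc (1 : ℤ) N) ∧
      ((f 0).1 ^ 2 - (f 0).2 ^ 2) + ((f 1).1 ^ 2 - (f 1).2 ^ 2) +
        ((f 2).1 ^ 2 - (f 2).2 ^ 2) = 0 := by
    intro f hf
    rwa [hG, mem_filter, Fintype.mem_piFinset] at hf
  have hSG : S.card ≤ G.card := by
    apply card_le_card_of_injOn (fun x => ![(x 0, x 3), (x 1, x 4), (x 2, x 5)])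
    · intro x hx
      rw [mem_coe, hS, mem_filter, Fintype.mem_piFinset] at hx
      rw [mem_coe, hG, mem_filter, Fintype.mem_piFinset]
      refine ⟨?_, ?_⟩
      · intro l
        rw [mem_product]
        fin_cases l
        · exact ⟨hx.1 0, hx.1 3⟩
        · exact ⟨hx.1 1, hx.1 4⟩
        · exact ⟨hx.1 2, hx.1 5⟩
      · simp
        linarith [hx.2]
    · intro x _ y _ hxy
      have h0 := congrFun hxy 0
      have h1 := congrFun hxy 1
      have h2 := congrFun hxy 2
      simp at h0 h1 h2
      funext l
      fin_cases l <;> simp [h0, h1, h2]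
  set u : (Fin 3 → ℤ × ℤ) → Fin 3 → ℤ := fun f l => (f l).1 - (f l).2 with hu
  let P : Fin 3 → Fin 3 → Fin 3 → Finset (Fin 3 → ℤ × ℤ) := fun i j k => G.filter fun f =>
    u f k ≠ 0 ∧ (u f i).natAbs ≤ (u f k).natAbs ∧ (u f j).natAbs ≤ (u f k).natAbs
  let Z := G.filter fun f => u f 0 = 0 ∧ u f 1 = 0 ∧ u f 2 = 0
  have hsub : G ⊆ ((P 0 1 2 ∪ P 0 2 1) ∪ P 1 2 0) ∪ Z := by
    intro f hf
    simp only [P, Z, mem_union, mem_filter, hf, true_and]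
    omega
  have hP1 : (P 0 1 2).card ≤ 162 * (2 * N) ^ 4 := by
    apply aux_part N 0 1 2 (by decide)
    intro f hf
    obtain ⟨h, h0, h1, h2⟩ := mem_filter.1 hf
    exact ⟨(hGm f h).1, by linarith [(hGm f h).2], h0, h1, h2⟩
  have hP2 : (P 0 2 1).card ≤ 162 * (2 * N) ^ 4 := by
    apply aux_part N 0 2 1 (by decide)
    intro f hf
    obtain ⟨h, h0, h1, h2⟩ := mem_filter.1 hf
    exact ⟨(hGm f h).1, by linarith [(hGm f h).2], h0, h1, h2⟩
  have hP3 : (P 1 2 0).card ≤ 162 * (2 * N) ^ 4 := by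
    apply aux_part N 1 2 0 (by decide)
    intro f hf
    obtain ⟨h, h0, h1, h2⟩ := mem_filter.1 hf
    exact ⟨(hGm f h).1, by linarith [(hGm f h).2], h0, h1, h2⟩
  have hZ : Z.card ≤ N ^ 3 := by
    have : Z.card ≤ (Fintype.piFinset fun _ : Fin 3 => Icc (1 : ℤ) (N : ℤ)).card := by
      apply card_le_card_of_injOn (fun f l => (f l).1)
      · intro f hf
        have h := (hGm f (mem_filter.1 hf).1).1
        rw [mem_coe, Fintype.mem_piFinset]
        intro l
        exact (mem_product.1 (h l)).1
      · intro f hf g hg hfg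
        obtain ⟨-, f0, f1, f2⟩ := mem_filter.1 hf
        obtain ⟨-, g0, g1, g2⟩ := mem_filter.1 hg
        simp only [hu] at f0 f1 f2 g0 g1 g2
        have h0 := congrFun hfg 0
        have h1 := congrFun hfg 1
        have h2 := congrFun hfg 2
        simp only at h0 h1 h2
        funext l
        fin_cases l
        · apply Prod.ext <;> simp <;> omega
        · apply Prod.ext <;> simp <;> omega
        · apply Prod.ext <;> simp <;> omega
    simpa using this
  have hfin : S.card ≤ 10000 * N ^ 4 := by
    have h1 := card_le_card hsub
    have h2 := card_union_le ((P 0 1 2 ∪ P 0 2 1) ∪ P 1 2 0) Z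
    have h3 := card_union_le (P 0 1 2 ∪ P 0 2 1) (P 1 2 0)
    have h4 := card_union_le (P 0 1 2) (P 0 2 1)
    have h5 : N ^ 3 ≤ N ^ 4 := Nat.pow_le_pow_right hN (by norm_num)
    have h6 : (2 * N) ^ 4 = 16 * N ^ 4 := by ring
    omega
  exact_mod_cast hfin
end

section
/- There exist absolute constants C, c > 0 such that the following holds (Weyl's inequality). Let P ⊂ ℤ be a finite arithmetic progression with common difference q, let α ∈ ℝ, and let 0 < δ ≤ 1. Suppose that |∑_{x∈P} e(αx²)| ≥ δ|P|. Then either |P| ≤ C δ^{-C}, or there exists a positive integer q' ≤ C δ^{-C} such that ‖q' q² α‖ ≤ C δ^{-C} |P|^{-2}. -/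
theorem wi_pigeon (L : ℕ) (H : Finset ℤ) (hH : ∀ h ∈ H, -(L : ℤ) < h ∧ h < L) (D m : ℕ) (hD : 0 < D)
    (hc : (2 * ((L : ℝ) / D) + 2) * m < H.card) :
    ∃ x ∈ H, ∃ y ∈ H, (m : ℤ) ≤ y - x ∧ y - x < D := by
  classical
  have hDz : (0 : ℤ) < D := by exact_mod_cast hD
  have hmaps : ∀ h ∈ H, h / (D : ℤ) ∈ Finset.Icc (-((L / D : ℕ) : ℤ) - 1) ((L / D : ℕ) : ℤ) := by
    intro h hh
    obtain ⟨h1, h2⟩ := hH h hh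
    rw [Finset.mem_Icc]
    push_cast
    constructor
    · rw [Int.le_ediv_iff_mul_le hDz]
      have h3 := Int.mul_ediv_add_emod (L : ℤ) D
      have h4 := Int.emod_lt_of_pos (L : ℤ) hDz
      nlinarith
    · exact Int.ediv_le_ediv hDz h2.le
  have hcard : ((Finset.Icc (-((L / D : ℕ) : ℤ) - 1) ((L / D : ℕ) : ℤ)).card : ℝ) ≤ 2 * ((L : ℝ) / D) + 2 := by
    rw [Int.card_Icc]
    have e : (((L / D : ℕ) : ℤ) + 1 - (-((L / D : ℕ) : ℤ) - 1)).toNat = 2 * (L / D) + 2 := by omega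
    rw [e]
    push_cast
    have := @Nat.cast_div_le ℝ _ _ _ L D
    linarith
  have hlt : (Finset.Icc (-((L / D : ℕ) : ℤ) - 1) ((L / D : ℕ) : ℤ)).card * m < H.card := by
    have : ((Finset.Icc (-((L / D : ℕ) : ℤ) - 1) ((L / D : ℕ) : ℤ)).card : ℝ) * m < H.card :=
      lt_of_le_of_lt (mul_le_mul_of_nonneg_right hcard (Nat.cast_nonneg m)) hc
    exact_mod_cast this
  obtain ⟨c, -, hcc⟩ := Finset.exists_lt_card_fiber_of_mul_lt_card_of_maps_to hmaps hlt
  set F := H.filter (fun x => x / (D : ℤ) = c) with hF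
  have hne : F.Nonempty := Finset.card_pos.mp (by omega)
  have hmin := Finset.min'_mem F hne
  have hmax := Finset.max'_mem F hne
  refine ⟨F.min' hne, (Finset.mem_filter.mp hmin).1, F.max' hne, (Finset.mem_filter.mp hmax).1, ?_, ?_⟩
  · have hsub : F ⊆ Finset.Icc (F.min' hne) (F.max' hne) := by
      intro x hx
      exact Finset.mem_Icc.mpr ⟨Finset.min'_le _ _ hx, Finset.le_max' _ _ hx⟩
    have := Finset.card_le_card hsub
    rw [Int.card_Icc] at this
    omega
  · have h1 := (Finset.mem_filter.mp hmin).2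
    have h2 := (Finset.mem_filter.mp hmax).2
    have a1 := Int.mul_ediv_add_emod (F.min' hne) D
    have a2 := Int.mul_ediv_add_emod (F.max' hne) D
    rw [h1] at a1
    rw [h2] at a2
    have b1 := Int.emod_nonneg (F.min' hne) hDz.ne'
    have b2 := Int.emod_lt_of_pos (F.max' hne) hDz
    linarith

theorem wi_recur (θ t : ℝ) (L : ℕ) (ht : 0 < t) (ht1 : t ≤ 1) (hL : 400 / t ^ 2 ≤ L)
    (H : Finset ℤ) (hH : ∀ h ∈ H, -(L : ℤ) < h ∧ h < L) (hc : t * L / 2 ≤ H.card)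
    (hn : ∀ h ∈ H, ∃ n : ℤ, |(h : ℝ) * θ - n| ≤ 2 / (t * L)) :
    ∃ d : ℕ, 0 < d ∧ (d : ℝ) ≤ 16 / t ∧ ∃ n : ℤ, |(d : ℝ) * θ - n| ≤ 25600 / (t ^ 4 * L ^ 2) := by
  have hL2 : 400 ≤ t ^ 2 * L := by
    rw [div_le_iff₀ (by positivity)] at hL
    linarith
  have hLp : (0 : ℝ) < L := by
    by_contra h
    have : (L : ℝ) = 0 := le_antisymm (not_lt.mp h) (Nat.cast_nonneg _)
    rw [this] at hL2
    norm_num at hL2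
  have hL1 : 400 ≤ t * L := by nlinarith [mul_pos ht hLp]
  have hdiff : ∀ x ∈ H, ∀ y ∈ H, ∃ n : ℤ, |((y - x : ℤ) : ℝ) * θ - n| ≤ 4 / (t * L) := by
    intro x hx y hy
    obtain ⟨n, h1⟩ := hn x hx
    obtain ⟨m, h2⟩ := hn y hy
    refine ⟨m - n, ?_⟩
    have e : ((y - x : ℤ) : ℝ) * θ - ((m - n : ℤ) : ℝ) = ((y : ℝ) * θ - m) - ((x : ℝ) * θ - n) := by
      push_cast; ring
    rw [e]
    refine (abs_sub _ _).trans ?_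
    have : (4 : ℝ) / (t * L) = 2 / (t * L) + 2 / (t * L) := by ring
    linarith
  -- step d
  obtain ⟨x, hx, y, hy, hxy1, hxy2⟩ := wi_pigeon L H hH ⌈16 / t⌉₊ 1 (Nat.ceil_pos.mpr (by positivity)) (by
    have h1 : 16 / t ≤ (⌈16 / t⌉₊ : ℝ) := Nat.le_ceil _
    have h2 : (L : ℝ) / ⌈16 / t⌉₊ ≤ L / (16 / t) :=
      div_le_div_of_nonneg_left hLp.le (by positivity) h1
    have h3 : (L : ℝ) / (16 / t) = t * L / 16 := by field_simp
    push_cast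
    linarith)
  obtain ⟨d, hd⟩ : ∃ d : ℕ, (d : ℤ) = y - x := ⟨(y - x).toNat, by omega⟩
  have hd0 : 0 < d := by omega
  have hd16 : (d : ℝ) ≤ 16 / t := by
    have : d < ⌈16 / t⌉₊ := by omega
    exact (Nat.lt_ceil.mp this).le
  obtain ⟨n, hη⟩ := hdiff x hx y hy
  rw [← hd] at hη
  -- step k
  have hW1 : (⌊t * L / 16⌋₊ : ℝ) ≤ t * L / 16 := Nat.floor_le (by positivity)
  have hW2 : t * L / 16 < (⌊t * L / 16⌋₊ : ℝ) + 1 := Nat.lt_floor_add_one _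
  have hm1 : (⌊t ^ 2 * L / 200⌋₊ : ℝ) ≤ t ^ 2 * L / 200 := Nat.floor_le (by positivity)
  have hm2 : t ^ 2 * L / 200 < (⌊t ^ 2 * L / 200⌋₊ : ℝ) + 1 := Nat.lt_floor_add_one _
  have hW0 : t * L / 32 ≤ (⌊t * L / 16⌋₊ : ℝ) := by linarith
  obtain ⟨u, hu, v, hv, huv1, huv2⟩ := wi_pigeon L H hH ⌊t * L / 16⌋₊ ⌊t ^ 2 * L / 200⌋₊
    (by
      have : (0 : ℝ) < (⌊t * L / 16⌋₊ : ℝ) := by linarith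
      exact_mod_cast this) (by
    have h2 : (L : ℝ) / ⌊t * L / 16⌋₊ ≤ L / (t * L / 32) :=
      div_le_div_of_nonneg_left hLp.le (by positivity) hW0
    have h3 : (L : ℝ) / (t * L / 32) = 32 / t := by field_simp
    have h4 : 2 ≤ 2 / t := by
      rw [le_div_iff₀ ht]; linarith
    have h5 : 2 * ((L : ℝ) / ⌊t * L / 16⌋₊) + 2 ≤ 66 / t := by
      have : 66 / t = 2 * (32 / t) + 2 / t := by ring
      linarith
    calc _ ≤ 66 / t * (t ^ 2 * L / 200) := by gcongr
      _ = 33 / 100 * (t * L) := by field_simp; ring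
      _ < t * L / 2 := by linarith
      _ ≤ _ := hc)
  obtain ⟨n', hξ⟩ := hdiff u hu v hv
  set k : ℝ := ((v - u : ℤ) : ℝ) with hk
  have hk1 : t ^ 2 * L / 400 ≤ k := by
    have : ((⌊t ^ 2 * L / 200⌋₊ : ℤ) : ℝ) ≤ k := by rw [hk]; exact_mod_cast huv1
    push_cast at this
    linarith
  have hk2 : k ≤ t * L / 16 := by
    have : k < ((⌊t * L / 16⌋₊ : ℤ) : ℝ) := by rw [hk]; exact_mod_cast huv2
    push_cast at this
    linarith
  have hk0 : 0 < k := by linarith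
  refine ⟨d, hd0, hd16, n, ?_⟩
  have hη' : |(d : ℝ) * θ - n| ≤ 4 / (t * L) := by exact_mod_cast hη
  set η := (d : ℝ) * θ - n with hηd
  set ξ := k * θ - n' with hξd
  have e1 : k * |η| ≤ 1 / 4 := by
    calc k * |η| ≤ (t * L / 16) * (4 / (t * L)) := by gcongr
      _ = 1 / 4 := by field_simp; norm_num
  have e2 : d * |ξ| ≤ 64 / (t ^ 2 * L) := by
    calc d * |ξ| ≤ (16 / t) * (4 / (t * L)) := by gcongr
      _ = _ := by field_simp; norm_num
  have e3 : 64 / (t ^ 2 * L) ≤ 1 / 4 := by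
    rw [div_le_iff₀ (by positivity)]; linarith
  have e4 : k * η - d * ξ = ((d * n' - (v - u) * n : ℤ) : ℝ) := by
    rw [hηd, hξd, hk]; push_cast; ring
  have e5 : |k * η - d * ξ| ≤ 1 / 2 := by
    refine (abs_sub _ _).trans ?_
    rw [abs_mul, abs_mul, abs_of_pos hk0, Nat.abs_cast]
    linarith
  have e6 : (d * n' - (v - u) * n : ℤ) = 0 := by
    rw [e4] at e5
    rw [← Int.abs_lt_one_iff]
    have : ((|(d * n' - (v - u) * n : ℤ)| : ℤ) : ℝ) < 1 := by
      rw [Int.cast_abs]; linarith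
    exact_mod_cast this
  rw [e6, Int.cast_zero, sub_eq_zero] at e4
  have e7 : k * |η| = d * |ξ| := by
    have := congrArg abs e4
    rwa [abs_mul, abs_mul, abs_of_pos hk0, Nat.abs_cast] at this
  have e8 : |η| ≤ (64 / (t ^ 2 * L)) / k := by
    rw [le_div_iff₀ hk0]; linarith
  calc |η| ≤ (64 / (t ^ 2 * L)) / k := e8
    _ ≤ (64 / (t ^ 2 * L)) / (t ^ 2 * L / 400) := by gcongr
    _ = _ := by field_simp; norm_num

/-- e -/
noncomputable def wiE (x : ℝ) : ℂ := Complex.exp (2 * (Real.pi : ℂ) * Complex.I * (x : ℂ))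

theorem wiE_eq (x : ℝ) : wiE x = Complex.exp (Complex.I * ((2 * Real.pi * x : ℝ) : ℂ)) := by
  unfold wiE; congr 1; push_cast; ring

theorem wiE_add (x y : ℝ) : wiE (x + y) = wiE x * wiE y := by
  unfold wiE; rw [← Complex.exp_add]; congr 1; push_cast; ring

theorem wiE_norm (x : ℝ) : ‖wiE x‖ = 1 := by
  rw [wiE_eq, mul_comm, Complex.norm_exp_ofReal_mul_I]

theorem wiE_conj (x : ℝ) : (starRingEnd ℂ) (wiE x) = wiE (-x) := by
  rw [wiE_eq, wiE_eq, ← Complex.exp_conj, map_mul, Complex.conj_I, Complex.conj_ofReal]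
  congr 1; push_cast; ring

theorem wiE_int (n : ℤ) : wiE n = 1 := by
  unfold wiE
  rw [Complex.exp_eq_one_iff]
  exact ⟨n, by push_cast; ring⟩

theorem wiE_sub_one (γ : ℝ) : 4 * |γ - round γ| ≤ ‖wiE γ - 1‖ := by
  have h1 : wiE γ = wiE (γ - round γ) := by
    have := wiE_add (γ - round γ) (round γ)
    rw [wiE_int, mul_one, sub_add_cancel] at this
    exact this
  have h2 : |γ - round γ| ≤ 1 / 2 := abs_sub_round γ
  set s := γ - round γ
  rw [h1, wiE_eq, Complex.norm_exp_I_mul_ofReal_sub_one, norm_mul, Real.norm_eq_abs, Real.norm_eq_abs]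
  have e : 2 * Real.pi * s / 2 = Real.pi * s := by ring
  rw [e]
  have h3 : |Real.pi * s| ≤ Real.pi / 2 := by
    rw [abs_mul, abs_of_pos Real.pi_pos]
    nlinarith [Real.pi_pos]
  have h4 := Real.mul_abs_le_abs_sin h3
  rw [abs_mul Real.pi s, abs_of_pos Real.pi_pos] at h4
  have h5 : 2 / Real.pi * (Real.pi * |s|) = 2 * |s| := by
    field_simp
  rw [h5] at h4
  rw [abs_of_pos (by norm_num : (0 : ℝ) < 2)]
  linarith

theorem wi_geom (γ : ℝ) (A B : ℤ) :
    ‖∑ l ∈ Finset.Icc A B, wiE (γ * l)‖ * (4 * |γ - round γ|) ≤ 2 := by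
  have key : ∀ n : ℕ, (∑ l ∈ Finset.Ico A (A + n), wiE (γ * l)) * (wiE γ - 1)
      = wiE (γ * ((A + n : ℤ) : ℝ)) - wiE (γ * A) := by
    intro n
    induction n with
    | zero => simp
    | succ n ih =>
      have e : Finset.Ico A (A + ((n + 1 : ℕ) : ℤ)) = insert (A + (n : ℤ)) (Finset.Ico A (A + n)) := by
        ext z; simp only [Finset.mem_Ico, Finset.mem_insert]; push_cast; omega
      rw [e, Finset.sum_insert (by simp), add_mul, ih]
      have e2 : wiE (γ * ((A + ((n + 1 : ℕ) : ℤ) : ℤ) : ℝ)) = wiE (γ * ((A + n : ℤ) : ℝ)) * wiE γ := by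
        rw [← wiE_add]; congr 1; push_cast; ring
      rw [e2]; ring
  by_cases hAB : A ≤ B
  · obtain ⟨n, hn⟩ : ∃ n : ℕ, (n : ℤ) = B + 1 - A := ⟨(B + 1 - A).toNat, by omega⟩
    have e : Finset.Icc A B = Finset.Ico A (A + n) := by
      ext z; simp only [Finset.mem_Ico, Finset.mem_Icc]; omega
    rw [e]
    calc _ ≤ ‖∑ l ∈ Finset.Ico A (A + n), wiE (γ * l)‖ * ‖wiE γ - 1‖ := by
          gcongr; exact wiE_sub_one γ
      _ = ‖wiE (γ * ((A + n : ℤ) : ℝ)) - wiE (γ * A)‖ := by rw [← norm_mul, key]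
      _ ≤ ‖wiE (γ * ((A + n : ℤ) : ℝ))‖ + ‖wiE (γ * A)‖ := norm_sub_le _ _
      _ = 2 := by rw [wiE_norm, wiE_norm]; norm_num
  · rw [Finset.Icc_eq_empty hAB]; simp

/-- inner sum -/
noncomputable def wiT (β : ℝ) (L : ℕ) (h : ℤ) : ℂ :=
  ∑ l ∈ Finset.Icc (max 1 (1 - h)) (min (L : ℤ) (L - h)), wiE (2 * β * h * l)

theorem wiT_le (β : ℝ) (L : ℕ) (h : ℤ) : ‖wiT β L h‖ ≤ L := by
  unfold wiT
  refine (norm_sum_le _ _).trans ?_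
  simp only [wiE_norm, Finset.sum_const, nsmul_eq_mul, mul_one, Int.card_Icc]
  have : (min (L : ℤ) (L - h) + 1 - max 1 (1 - h)).toNat ≤ L := by omega
  exact_mod_cast this

theorem wi_sq (a q : ℤ) (L : ℕ) (α : ℝ) :
    ‖∑ k ∈ Finset.Icc (1 : ℤ) (L : ℤ), wiE (α * (((a + q * k : ℤ) : ℝ)) ^ 2)‖ ^ 2 ≤
      ∑ h ∈ Finset.Ioo (-(L : ℤ)) L, ‖wiT ((q : ℝ) ^ 2 * α) L h‖ := by
  classical
  set I := Finset.Icc (1 : ℤ) (L : ℤ) with hI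
  set f : ℤ → ℝ := fun k => α * (((a + q * k : ℤ) : ℝ)) ^ 2 with hf
  have h1 : ‖∑ k ∈ I, wiE (f k)‖ ^ 2 = ‖∑ p ∈ I ×ˢ I, wiE (f p.1 - f p.2)‖ := by
    have : ∑ p ∈ I ×ˢ I, wiE (f p.1 - f p.2) =
        (∑ k ∈ I, wiE (f k)) * (starRingEnd ℂ) (∑ k ∈ I, wiE (f k)) := by
      rw [map_sum, Finset.sum_mul_sum, Finset.sum_product]
      refine Finset.sum_congr rfl fun k _ => Finset.sum_congr rfl fun l _ => ?_
      rw [wiE_conj, ← wiE_add, sub_eq_add_neg]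
    rw [this, norm_mul, RCLike.norm_conj, sq]
  rw [h1, ← Finset.sum_fiberwise_of_maps_to (s := I ×ˢ I) (t := Finset.Ioo (-(L : ℤ)) L)
    (g := fun p => p.1 - p.2) (by
      intro p hp
      simp only [hI, Finset.mem_product, Finset.mem_Icc] at hp
      rw [Finset.mem_Ioo]
      omega)]
  refine (norm_sum_le _ _).trans (Finset.sum_le_sum fun h _ => le_of_eq ?_)
  have h2 : ∑ p ∈ (I ×ˢ I).filter (fun p => p.1 - p.2 = h), wiE (f p.1 - f p.2) =
      ∑ l ∈ Finset.Icc (max 1 (1 - h)) (min (L : ℤ) (L - h)), wiE (f (l + h) - f l) := by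
    symm
    refine Finset.sum_bij (fun l _ => (l + h, l)) ?_ ?_ ?_ ?_
    · intro l hl
      simp only [Finset.mem_Icc] at hl
      simp only [hI, Finset.mem_filter, Finset.mem_product, Finset.mem_Icc]
      omega
    · intro l _ l' _ hll
      exact (Prod.mk.inj hll).2
    · rintro ⟨k, l⟩ hp
      simp only [hI, Finset.mem_filter, Finset.mem_product, Finset.mem_Icc] at hp
      refine ⟨l, ?_, ?_⟩
      · simp only [Finset.mem_Icc]; omega
      · ext
        · show l + h = k
          omega
        · rfl
    · intro l _; rfl
  rw [h2]
  have h3 : ∀ l : ℤ, wiE (f (l + h) - f l) =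
      wiE (α * (2 * a * q * h + q ^ 2 * h ^ 2)) * wiE (2 * ((q : ℝ) ^ 2 * α) * h * l) := by
    intro l
    rw [← wiE_add, hf]
    congr 1
    push_cast
    ring
  simp only [h3]
  rw [← Finset.mul_sum, norm_mul, wiE_norm, one_mul]
  rfl

theorem wi_main (a q : ℤ) (L : ℕ) (α δ : ℝ) (hL : 0 < L) (hδ : 0 < δ) (hδ1 : δ ≤ 1)
    (hS : δ * L ≤ ‖∑ k ∈ Finset.Icc (1 : ℤ) (L : ℤ), wiE (α * (((a + q * k : ℤ) : ℝ)) ^ 2)‖)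
    (hbig : 400 / (δ ^ 2) ^ 2 ≤ L) :
    ∃ d : ℕ, 0 < d ∧ (d : ℝ) ≤ 16 / δ ^ 2 ∧
      ∃ n : ℤ, |(d : ℝ) * (2 * ((q : ℝ) ^ 2 * α)) - n| ≤ 25600 / ((δ ^ 2) ^ 4 * L ^ 2) := by
  classical
  have hLp : (0 : ℝ) < L := by exact_mod_cast hL
  set β := (q : ℝ) ^ 2 * α with hβ
  have hsq : δ ^ 2 * L ^ 2 ≤ ∑ h ∈ Finset.Ioo (-(L : ℤ)) L, ‖wiT β L h‖ := by
    refine le_trans ?_ (wi_sq a q L α)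
    rw [← mul_pow]
    gcongr
  set H := (Finset.Ioo (-(L : ℤ)) L).filter (fun h => δ ^ 2 * L / 4 ≤ ‖wiT β L h‖) with hH
  refine wi_recur (2 * β) (δ ^ 2) L (by positivity) (pow_le_one₀ hδ.le hδ1) hbig H ?_ ?_ ?_
  · intro h hh
    exact Finset.mem_Ioo.mp (Finset.mem_filter.mp hh).1
  · rw [← Finset.sum_filter_add_sum_filter_not _ (fun h => δ ^ 2 * L / 4 ≤ ‖wiT β L h‖)] at hsq
    have b1 : ∑ h ∈ H, ‖wiT β L h‖ ≤ H.card * L := by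
      refine (Finset.sum_le_card_nsmul _ _ (L : ℝ) fun h _ => wiT_le β L h).trans ?_
      rw [nsmul_eq_mul]
    have b2 : ∑ h ∈ (Finset.Ioo (-(L : ℤ)) L).filter (fun h => ¬ (δ ^ 2 * L / 4 ≤ ‖wiT β L h‖)), ‖wiT β L h‖
        ≤ (2 * L) * (δ ^ 2 * L / 4) := by
      refine (Finset.sum_le_card_nsmul _ _ (δ ^ 2 * L / 4) fun h hh =>
        (not_le.mp (Finset.mem_filter.mp hh).2).le).trans ?_
      rw [nsmul_eq_mul]
      gcongr
      have : ((Finset.Ioo (-(L : ℤ)) L).filter (fun h => ¬ (δ ^ 2 * L / 4 ≤ ‖wiT β L h‖))).card ≤ 2 * L := by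
        refine (Finset.card_filter_le _ _).trans ?_
        rw [Int.card_Ioo]
        omega
      exact_mod_cast this
    have b3 : δ ^ 2 * L / 2 * L ≤ H.card * L := by
      nlinarith
    exact le_of_mul_le_mul_right b3 hLp
  · intro h hh
    refine ⟨round ((h : ℝ) * (2 * β)), ?_⟩
    have h1 := (Finset.mem_filter.mp hh).2
    have h2 := wi_geom ((h : ℝ) * (2 * β)) (max 1 (1 - h)) (min (L : ℤ) (L - h))
    have h3 : ∑ l ∈ Finset.Icc (max 1 (1 - h)) (min (L : ℤ) (L - h)), wiE ((h : ℝ) * (2 * β) * l)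
        = wiT β L h := by
      unfold wiT
      refine Finset.sum_congr rfl fun l _ => ?_
      congr 1; ring
    rw [h3] at h2
    rw [le_div_iff₀ (by positivity)]
    have h4 := mul_le_mul_of_nonneg_right h1
      (by positivity : 0 ≤ 4 * |(h : ℝ) * (2 * β) - round ((h : ℝ) * (2 * β))|)
    linarith

/-- **Weyl's inequality.**  Here the arithmetic progression `P` with common difference
`q` and `|P| = L` is `{a + q, a + 2q, …, a + Lq}`, so `∑_{x ∈ P} e(αx²)` is the sum
below, with `e(θ) = exp(2πiθ)`; the distance of `θ` to the nearest integer is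
`|θ - round θ|`. -/
theorem weyl_inequality :
    ∃ C : ℝ, 0 < C ∧
      ∀ (a q : ℤ) (L : ℕ) (α δ : ℝ), 0 < L → 0 < δ → δ ≤ 1 →
        δ * L ≤ ‖∑ k ∈ Finset.Icc (1 : ℤ) (L : ℤ),
            Complex.exp (2 * (Real.pi : ℂ) * Complex.I *
              ((α * (((a + q * k : ℤ) : ℝ)) ^ 2 : ℝ) : ℂ))‖ →
        ((L : ℝ) ≤ C * δ ^ (-C) ∨
          ∃ q' : ℕ, 0 < q' ∧ (q' : ℝ) ≤ C * δ ^ (-C) ∧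
            |(q' : ℝ) * (q : ℝ) ^ 2 * α -
                ((round ((q' : ℝ) * (q : ℝ) ^ 2 * α) : ℤ) : ℝ)| ≤
              C * δ ^ (-C) / (L : ℝ) ^ 2) := by
  refine ⟨25600, by norm_num, ?_⟩
  intro a q L α δ hL hδ hδ1 hS
  have hpow : ∀ (c : ℝ) (n : ℕ), 0 ≤ c → c ≤ 25600 → n ≤ 25600 →
      c / δ ^ n ≤ 25600 * δ ^ (-(25600 : ℝ)) := by
    intro c n hc0 hc hn
    have h1 : (δ ^ n)⁻¹ = δ ^ (-(n : ℝ)) := by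
      rw [Real.rpow_neg hδ.le, Real.rpow_natCast]
    rw [div_eq_mul_inv, h1]
    have h2 : δ ^ (-(n : ℝ)) ≤ δ ^ (-(25600 : ℝ)) := by
      apply Real.rpow_le_rpow_of_exponent_ge hδ hδ1
      have : (n : ℝ) ≤ 25600 := by exact_mod_cast hn
      linarith
    have h3 : 0 ≤ δ ^ (-(n : ℝ)) := Real.rpow_nonneg hδ.le _
    gcongr
  by_cases hbig : 400 / (δ ^ 2) ^ 2 ≤ (L : ℝ)
  · right
    obtain ⟨d, hd0, hd, n, hn⟩ := wi_main a q L α δ hL hδ hδ1 hS hbig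
    refine ⟨2 * d, by omega, ?_, ?_⟩
    · have := hpow 32 2 (by norm_num) (by norm_num) (by norm_num)
      have e : (32 : ℝ) / δ ^ 2 = 2 * (16 / δ ^ 2) := by ring
      push_cast
      linarith
    · refine (round_le _ n).trans ?_
      have e : ((2 * d : ℕ) : ℝ) * (q : ℝ) ^ 2 * α - n = (d : ℝ) * (2 * ((q : ℝ) ^ 2 * α)) - n := by
        push_cast; ring
      rw [e]
      refine hn.trans ?_
      have := hpow 25600 8 (by norm_num) (by norm_num) (by norm_num)
      rw [← pow_mul, ← div_div]
      gcongr
  · left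
    have := hpow 400 4 (by norm_num) (by norm_num) (by norm_num)
    rw [← pow_mul] at hbig
    norm_num at hbig
    linarith
end

section
/- There exist absolute constants C, c > 0 such that the following holds. Let N be a positive integer and define f : ℤ → ℂ by setting, for positive integers x₁, x₂ ≤ N^{1/2}, f(x₁ + (x₂−1)⌊N^{1/2}⌋) equal to 1 if x₂ ≡ 0 (mod 4), 0 if x₂ ≡ 1 (mod 4), −1 if x₂ ≡ 2 (mod 4), and 0 if x₂ ≡ 3 (mod 4); and f(x) = 0 for all other x. Let g := f and h := the indicator function of [N]. Then either N ≤ C, or ∑_{x∈ℤ} ∑_{y∈ℕ} f(x) g(x+y) h(x+y²) ≥ c N^{3/2}. -/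
/-- **The obstruction example has many nonlinear Roth configurations.**
The function `f` is specified by `f(x₁ + (x₂ - 1)⌊√N⌋)` according to `x₂ mod 4` for
positive integers `x₁, x₂ ≤ √N`, and `f = 0` elsewhere; `g = f`, and `h = 1_{[N]}`.
Since `f` is supported in `[N]`, the double sum `∑_{x ∈ ℤ} ∑_{y ∈ ℕ}` equals the finite
sum over `x ∈ [N]`, `y ∈ [N]` below (and the whole sum is real, so we take real parts). -/
theorem obstruction_example_many_configurations :
    ∃ C c : ℝ, 0 < C ∧ 0 < c ∧
      ∀ (N : ℕ) (f : ℤ → ℂ),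
        (∀ x₁ x₂ : ℤ, 1 ≤ x₁ → (x₁ : ℝ) ≤ Real.sqrt N → 1 ≤ x₂ → (x₂ : ℝ) ≤ Real.sqrt N →
          f (x₁ + (x₂ - 1) * (Nat.sqrt N : ℤ)) =
            if x₂ % 4 = 0 then 1 else if x₂ % 4 = 2 then -1 else 0) →
        (∀ x : ℤ, (¬ ∃ x₁ x₂ : ℤ, 1 ≤ x₁ ∧ (x₁ : ℝ) ≤ Real.sqrt N ∧ 1 ≤ x₂ ∧
            (x₂ : ℝ) ≤ Real.sqrt N ∧ x = x₁ + (x₂ - 1) * (Nat.sqrt N : ℤ)) → f x = 0) →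
        ((N : ℝ) ≤ C ∨
          c * (N : ℝ) ^ ((3 : ℝ) / 2) ≤
            (∑ x ∈ Finset.Icc (1 : ℤ) (N : ℤ), ∑ y ∈ Finset.Icc (1 : ℤ) (N : ℤ),
                f x * f (x + y) *
                  (if x + y ^ 2 ∈ Finset.Icc (1 : ℤ) (N : ℤ) then 1 else 0)).re) := by
  refine ⟨100, 1 / 1024, by norm_num, by norm_num, ?_⟩
  intro N f hf1 hf0
  by_cases hN : (N : ℝ) ≤ 100
  · exact Or.inl hN
  right
  have hN' : 100 < N := by
    rw [not_le] at hN
    exact_mod_cast hN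
  obtain ⟨M, hM⟩ : ∃ M : ℤ, M = (Nat.sqrt N : ℤ) := ⟨_, rfl⟩
  have hMN : M ^ 2 ≤ (N : ℤ) := by
    rw [hM]; exact_mod_cast Nat.sqrt_le' N
  have hNM : (N : ℤ) < (M + 1) ^ 2 := by
    rw [hM]; exact_mod_cast Nat.lt_succ_sqrt' N
  have hM10 : 10 ≤ M := by
    rw [hM]
    have : 10 ≤ Nat.sqrt N := Nat.le_sqrt'.mpr (by omega)
    exact_mod_cast this
  have hfl : ∀ a : ℤ, (a : ℝ) ≤ Real.sqrt N ↔ a ≤ M := by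
    intro a
    rw [hM, ← Real.floor_real_sqrt_eq_nat_sqrt, Int.le_floor]
  simp only [hfl, ← hM] at hf1 hf0
  have hval : ∀ x : ℤ, 1 ≤ x → x ≤ M ^ 2 → f x = if ((x - 1) / M + 1) % 4 = 0 then 1 else
      if ((x - 1) / M + 1) % 4 = 2 then -1 else 0 := by
    intro x h1 h2
    have hq0 : 0 ≤ (x - 1) / M := Int.ediv_nonneg (by omega) (by omega)
    have hq1 : (x - 1) / M < M := Int.ediv_lt_of_lt_mul (by omega) (by nlinarith)
    have hr0 := Int.emod_nonneg (x - 1) (b := M) (by omega)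
    have hr1 := Int.emod_lt_of_pos (x - 1) (b := M) (by omega)
    have hd := Int.emod_add_mul_ediv (x - 1) M
    have := hf1 ((x - 1) % M + 1) ((x - 1) / M + 1) (by omega) (by omega) (by omega) (by omega)
    rw [← this]
    congr 1
    linarith
  have hzero : ∀ x : ℤ, M ^ 2 < x → f x = 0 := by
    intro x hx
    apply hf0
    rintro ⟨a, b, ha1, ha2, hb1, hb2, rfl⟩
    nlinarith
  have hnn : ∀ x ∈ Finset.Icc (1 : ℤ) (N : ℤ), ∀ y ∈ Finset.Icc (1 : ℤ) (N : ℤ),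
      0 ≤ (f x * f (x + y) *
        (if x + y ^ 2 ∈ Finset.Icc (1 : ℤ) (N : ℤ) then 1 else 0)).re := by
    intro x hx y hy
    rw [Finset.mem_Icc] at hx hy
    by_cases hh : x + y ^ 2 ∈ Finset.Icc (1 : ℤ) (N : ℤ)
    · rw [if_pos hh, mul_one]
      rw [Finset.mem_Icc] at hh
      have hyM : y ≤ M := by nlinarith
      by_cases hxy : x + y ≤ M ^ 2
      · rw [hval x (by omega) (by omega), hval (x + y) (by omega) hxy]
        have h1 : (x - 1) / M ≤ (x + y - 1) / M := Int.ediv_le_ediv (by omega) (by omega)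
        have h2 : (x + y - 1) / M ≤ (x - 1) / M + 1 := by
          rw [← Int.add_mul_ediv_right (x - 1) 1 (c := M) (by omega)]
          exact Int.ediv_le_ediv (by omega) (by omega)
        generalize (x - 1) / M = q at *
        generalize (x + y - 1) / M = q' at *
        split_ifs <;> first | (exfalso; omega) | simp
      · rw [hzero (x + y) (by omega)]; simp
    · rw [if_neg hh]; simp
  obtain ⟨K, hK⟩ : ∃ K : ℤ, K = M / 4 := ⟨_, rfl⟩
  obtain ⟨H, hH⟩ : ∃ H : ℤ, H = M / 2 := ⟨_, rfl⟩
  have hcount : (K * H * H : ℝ) ≤ (∑ x ∈ Finset.Icc (1 : ℤ) (N : ℤ),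
      ∑ y ∈ Finset.Icc (1 : ℤ) (N : ℤ), f x * f (x + y) *
        (if x + y ^ 2 ∈ Finset.Icc (1 : ℤ) (N : ℤ) then 1 else 0)).re := by
    rw [← Finset.sum_product', Complex.re_sum]
    let φ : (ℤ × ℤ) × ℤ → ℤ × ℤ := fun p => (p.1.2 + (2 * p.1.1 - 1) * M, p.2)
    let S : Finset ((ℤ × ℤ) × ℤ) := (Finset.Icc 1 K ×ˢ Finset.Icc 1 H) ×ˢ Finset.Icc 1 H
    have hinj : Set.InjOn φ S := by
      rintro ⟨⟨k, a⟩, y⟩ h1 ⟨⟨k', a'⟩, y'⟩ h2 h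
      simp only [S, Finset.coe_product, Set.mem_prod, Finset.coe_Icc, Set.mem_Icc] at h1 h2
      simp only [φ, Prod.mk.injEq] at h
      obtain ⟨h, rfl⟩ := h
      have e : k = k' := by
        rcases lt_trichotomy k k' with hlt | heq | hgt
        · have hm : 1 * M ≤ (k' - k) * M := mul_le_mul_of_nonneg_right (by omega) (by omega)
          have ha : a - a' = 2 * ((k' - k) * M) := by linarith
          omega
        · exact heq
        · have hm : 1 * M ≤ (k - k') * M := mul_le_mul_of_nonneg_right (by omega) (by omega)
          have ha : a' - a = 2 * ((k - k') * M) := by linarith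
          omega
      subst e
      have : a = a' := by linarith
      rw [this]
    have hcard : ((S.image φ).card : ℝ) = K * H * H := by
      rw [Finset.card_image_of_injOn hinj]
      simp only [S, Finset.card_product, Int.card_Icc]
      have e1 : ((K + 1 - 1).toNat : ℤ) = K := by omega
      have e2 : ((H + 1 - 1).toNat : ℤ) = H := by omega
      have e1' : ((K + 1 - 1).toNat : ℝ) = K := by exact_mod_cast e1
      have e2' : ((H + 1 - 1).toNat : ℝ) = H := by exact_mod_cast e2
      push_cast
      rw [e1', e2']
    have key : ∀ p ∈ S, φ p ∈ Finset.Icc (1 : ℤ) (N : ℤ) ×ˢ Finset.Icc (1 : ℤ) (N : ℤ) ∧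
        (1 : ℝ) ≤ (f (φ p).1 * f ((φ p).1 + (φ p).2) *
        (if (φ p).1 + (φ p).2 ^ 2 ∈ Finset.Icc (1 : ℤ) (N : ℤ) then 1 else 0)).re := by
      rintro ⟨⟨k, a⟩, y⟩ h1
      simp only [S, Finset.mem_product, Finset.mem_Icc] at h1
      obtain ⟨⟨⟨hk1, hk2⟩, ha1, ha2⟩, hy1, hy2⟩ := h1
      have hk : 4 * k ≤ M := by omega
      have ha : 2 * a ≤ M := by omega
      have hy : 2 * y ≤ M := by omega
      have hlow : M ≤ (2 * k - 1) * M := by nlinarith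
      have hup : 2 * ((2 * k - 1) * M) ≤ (M - 2) * M := by nlinarith
      have hup' : 2 * ((2 * k - 1) * M) ≤ M ^ 2 - 2 * M := by linarith
      have hy4 : 4 * y ^ 2 ≤ M ^ 2 := by nlinarith
      have hmem : a + (2 * k - 1) * M + y ^ 2 ∈ Finset.Icc (1 : ℤ) (N : ℤ) := by
        rw [Finset.mem_Icc]
        constructor
        · nlinarith
        · nlinarith
      have hyy : y ≤ y ^ 2 := by nlinarith
      refine ⟨?_, ?_⟩
      · simp only [φ, Finset.mem_product, Finset.mem_Icc] at hmem ⊢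
        refine ⟨⟨?_, ?_⟩, ?_, ?_⟩ <;> linarith
      · simp only [φ]
        rw [if_pos hmem]
        have e1 := hf1 a (2 * k) ha1 (by omega) (by omega) (by omega)
        have e2 := hf1 (a + y) (2 * k) (by omega) (by omega) (by omega) (by omega)
        have e3 : a + (2 * k - 1) * M + y = a + y + (2 * k - 1) * M := by ring
        rw [e3, e1, e2]
        split_ifs <;> first | (exfalso; omega) | simp
    calc (K * H * H : ℝ) = ∑ p ∈ S.image φ, (1 : ℝ) := by simp [hcard]
      _ ≤ ∑ p ∈ S.image φ, (f p.1 * f (p.1 + p.2) *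
        (if p.1 + p.2 ^ 2 ∈ Finset.Icc (1 : ℤ) (N : ℤ) then 1 else 0)).re := by
          apply Finset.sum_le_sum
          intro p hp
          obtain ⟨q, hq, rfl⟩ := Finset.mem_image.mp hp
          exact (key q hq).2
      _ ≤ _ := by
          apply Finset.sum_le_sum_of_subset_of_nonneg
          · intro p hp
            obtain ⟨q, hq, rfl⟩ := Finset.mem_image.mp hp
            exact (key q hq).1
          · intro p hp _
            rw [Finset.mem_product] at hp
            exact hnn p.1 hp.1 p.2 hp.2
  refine le_trans ?_ hcount
  have hMr : (10 : ℝ) ≤ M := by exact_mod_cast hM10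
  have hKr : (M : ℝ) / 8 ≤ K := by
    have : M ≤ 8 * K := by omega
    have : (M : ℝ) ≤ 8 * K := by exact_mod_cast this
    linarith
  have hHr : (M : ℝ) / 4 ≤ H := by
    have : M ≤ 4 * H := by omega
    have : (M : ℝ) ≤ 4 * H := by exact_mod_cast this
    linarith
  have hNr : (N : ℝ) ≤ (2 * M) ^ 2 := by
    have : (N : ℤ) ≤ (2 * M) ^ 2 := by nlinarith
    exact_mod_cast this
  have hpow : (N : ℝ) ^ ((3 : ℝ) / 2) ≤ (2 * M) ^ 3 := by
    calc (N : ℝ) ^ ((3 : ℝ) / 2) ≤ ((2 * M : ℝ) ^ 2) ^ ((3 : ℝ) / 2) :=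
          Real.rpow_le_rpow (by positivity) hNr (by norm_num)
      _ = (2 * M) ^ 3 := by
          rw [← Real.rpow_natCast, ← Real.rpow_natCast, ← Real.rpow_mul (by linarith)]
          norm_num
  have hprod : (M : ℝ) / 8 * (M / 4) * (M / 4) ≤ K * H * H := by
    have : (0 : ℝ) ≤ M / 4 := by linarith
    have : (0 : ℝ) ≤ M / 8 := by linarith
    have : (0 : ℝ) ≤ K := by linarith
    have : (0 : ℝ) ≤ H := by linarith
    have : (0 : ℝ) ≤ K * H := by positivity
    gcongr
  calc 1 / 1024 * (N : ℝ) ^ ((3 : ℝ) / 2) ≤ 1 / 1024 * (2 * M) ^ 3 := by gcongr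
    _ = (M : ℝ) / 8 * (M / 4) * (M / 4) := by ring
    _ ≤ _ := hprod
end

section
/- There is an absolute constant C > 0 such that the following holds. Let N be a positive integer and define f : ℤ → ℂ by setting, for positive integers x₁, x₂ ≤ N^{1/2}, f(x₁ + (x₂−1)⌊N^{1/2}⌋) equal to 1 if x₂ ≡ 0 (mod 4), 0 if x₂ ≡ 1 (mod 4), −1 if x₂ ≡ 2 (mod 4), and 0 if x₂ ≡ 3 (mod 4); and f(x) = 0 for all other x. Then for every finite arithmetic progression P ⊆ [N], |∑_{x∈P} f(x)| ≤ C N^{1/2}; and consequently, for every 0 < δ ≤ 1 and every 1-bounded local function φ of resolution at least δN and modulus at most δ^{-1}, |∑_{x∈ℤ} f(x) φ(x)| ≤ C δ^{-2} N^{1/2}. -/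
/-- `φ : ℤ → ℂ` is a *local function of resolution `M` and modulus `q`*. -/
def IsLocalFunction (φ : ℤ → ℂ) (M : ℝ) (q : ℕ) : Prop :=
  ∃ r : ℝ, ∀ x y : ℤ,
    ⌊((x : ℝ) - r) / M⌋ = ⌊((y : ℝ) - r) / M⌋ → x % (q : ℤ) = y % (q : ℤ) → φ x = φ y

noncomputable def hh (j : ℤ) : ℂ := if (j+1) % 4 = 0 then 1 else if (j+1) % 4 = 2 then -1 else 0

lemma hh_norm (j : ℤ) : ‖hh j‖ ≤ 1 := by
  unfold hh; split_ifs <;> simp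

lemma hh_two (j : ℤ) : hh (j+2) = - hh j := by
  unfold hh
  have h4 : (j+1) % 4 = 0 ∨ (j+1) % 4 = 1 ∨ (j+1) % 4 = 2 ∨ (j+1) % 4 = 3 := by omega
  rcases h4 with h | h | h | h
  · have : (j+2+1) % 4 = 2 := by omega
    simp [h, this]
  · have : (j+2+1) % 4 = 3 := by omega
    simp [h, this]
  · have : (j+2+1) % 4 = 0 := by omega
    simp [h, this]
  · have : (j+2+1) % 4 = 1 := by omega
    simp [h, this]

lemma shift_good (s d y e : ℤ) (hs : 0 < s) (he : 0 ≤ e) (hed : e < d) (hy : d ≤ y % s) :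
    hh ((y + (2*s - e)) / s) = - hh (y / s) := by
  have : (y + (2*s - e)) / s = y / s + 2 := by
    have h1 := Int.emod_add_mul_ediv y s
    have h2 := Int.emod_lt_of_pos y hs
    rw [show y + (2*s-e) = (y % s - e) + s * (y/s + 2) by linarith]
    rw [Int.add_mul_ediv_left _ _ hs.ne', Int.ediv_eq_zero_of_lt (by omega) (by omega)]
    ring
  rw [this, hh_two]

lemma card_bad (s d a : ℤ) (hs : 0 < s) (hd : 0 < d) (L : ℕ)
    (hb : ∀ k < L, 0 ≤ a + d * k ∧ a + d * k < s*s + 2*s) :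
    (((Finset.range L).filter (fun k : ℕ => (a + d * k) % s < d)).card : ℤ) ≤ s + 2 := by
  have : ((Finset.range L).filter (fun k : ℕ => (a + d * k) % s < d)).card
      ≤ (Finset.Ico (0:ℤ) (s+2)).card := by
    apply Finset.card_le_card_of_injOn (fun k : ℕ => (a + d * k) / s)
    · intro k hk
      simp only [Finset.coe_filter, Finset.mem_range, Set.mem_ofPred_eq] at hk
      have := hb k hk.1
      simp only [Finset.coe_Ico, Set.mem_Ico]
      exact ⟨Int.ediv_nonneg this.1 hs.le, Int.ediv_lt_of_lt_mul hs (by linarith [this.2])⟩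
    · intro k hk l hl hkl
      simp only [Finset.coe_filter, Finset.mem_range, Set.mem_ofPred_eq] at hk hl hkl
      have h1 := Int.emod_add_mul_ediv (a + d*k) s
      have h2 := Int.emod_add_mul_ediv (a + d*l) s
      have h3 := Int.emod_nonneg (a + d*k) hs.ne'
      have h4 := Int.emod_nonneg (a + d*l) hs.ne'
      rw [hkl] at h1
      have h5 : d * ((k:ℤ) - l) < d * 1 := by linarith [hk.2]
      have h6 : d * ((l:ℤ) - k) < d * 1 := by linarith [hl.2]
      have := lt_of_mul_lt_mul_left h5 hd.le
      have := lt_of_mul_lt_mul_left h6 hd.le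
      omega
  rw [Int.card_Ico] at this
  omega

lemma norm_sum_le_card {S : Finset ℕ} {u : ℕ → ℂ} (c : ℝ) (hu : ∀ k ∈ S, ‖u k‖ ≤ c) :
    ‖∑ k ∈ S, u k‖ ≤ S.card * c := by
  simpa using norm_sum_le_of_le S hu

lemma sum_hh (s d a : ℤ) (hs : 0 < s) (hd : 0 < d) (L : ℕ)
    (hb : ∀ k < L, 0 ≤ a + d * k ∧ a + d * k < s*s + 2*s) :
    ‖∑ k ∈ Finset.range L, hh ((a + d * k) / s)‖ ≤ 3 * s + 2 := by
  obtain ⟨m, hm⟩ := Int.eq_ofNat_of_zero_le (show 0 ≤ (2*s)/d from Int.ediv_nonneg (by linarith) hd.le)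
  have hm2 : (m:ℤ) ≤ 2*s := by
    rw [← hm]; exact Int.ediv_le_self _ (by linarith)
  have hme := Int.emod_add_mul_ediv (2*s) d
  rw [hm] at hme
  set F : ℕ → ℂ := fun k => hh ((a + d * k) / s) with hF
  have hFn : ∀ k, ‖F k‖ ≤ 1 := fun k => hh_norm _
  have e1 : ∑ k ∈ Finset.range L, F (k+m) + ∑ k ∈ Finset.range m, F k
      = ∑ k ∈ Finset.range L, F k + ∑ k ∈ Finset.range m, F (L+k) := by
    rw [← Finset.sum_range_add, add_comm L m, Finset.sum_range_add, add_comm]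
    simp [add_comm]
  have e2 : ‖∑ k ∈ Finset.range L, (F k + F (k+m))‖ ≤ (s+2) * 2 := by
    rw [← Finset.sum_filter_of_ne (p := fun k : ℕ => (a + d * k) % s < d)]
    · refine (norm_sum_le_card 2 ?_).trans ?_
      · intro k _
        exact (norm_add_le _ _).trans (by linarith [hFn k, hFn (k+m)])
      · have := card_bad s d a hs hd L hb
        gcongr
        exact_mod_cast this
    · intro k _ hne
      by_contra hcon
      push Not at hcon
      apply hne
      have := shift_good s d (a + d*k) ((2*s) % d) hs (Int.emod_nonneg _ hd.ne')
        (Int.emod_lt_of_pos _ hd) hcon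
      simp only [hF]
      rw [show a + d * ((k+m : ℕ):ℤ) = a + d*k + (2*s - 2*s % d) by push_cast; linarith, this]
      ring
  have e3 : ‖∑ k ∈ Finset.range m, F k‖ ≤ m := by
    simpa using norm_sum_le_card (S := Finset.range m) 1 (fun k _ => hFn k)
  have e4 : ‖∑ k ∈ Finset.range m, F (L+k)‖ ≤ m := by
    simpa using norm_sum_le_card (S := Finset.range m) 1 (fun k _ => hFn (L+k))
  have e5 : 2 * ∑ k ∈ Finset.range L, F k = ∑ k ∈ Finset.range L, (F k + F (k+m))
      + ∑ k ∈ Finset.range m, F k - ∑ k ∈ Finset.range m, F (L+k) := by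
    rw [Finset.sum_add_distrib]; linear_combination -e1
  have e6 : ‖2 * ∑ k ∈ Finset.range L, F k‖ ≤ (s+2)*2 + m + m := by
    rw [e5]
    exact (norm_sub_le _ _).trans (add_le_add ((norm_add_le _ _).trans (add_le_add e2 e3)) e4)
  rw [norm_mul] at e6
  simp at e6
  have : (m:ℝ) ≤ 2*s := by exact_mod_cast hm2
  linarith

/-- AP bound, positive step, range form. -/
lemma ap_pos (N s : ℤ) (hs : 0 < s) (hN : N ≤ s*s+2*s) (f : ℤ → ℂ)
    (h1 : ∀ x, 1 ≤ x → x ≤ s*s → f x = hh ((x-1)/s)) (h2 : ∀ x, s*s < x → f x = 0)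
    (a d : ℤ) (hd : 0 < d) (L : ℕ) (hb : ∀ k < L, 1 ≤ a + d * (k:ℤ) ∧ a + d * k ≤ N) :
    ‖∑ k ∈ Finset.range L, f (a + d * (k:ℤ))‖ ≤ 7 * s := by
  have A := sum_hh s d (a-1) hs hd L (fun k hk => by have := hb k hk; constructor <;> linarith)
  set T := (Finset.range L).filter (fun k : ℕ => s*s < a + d * (k:ℤ)) with hT
  have hc : T.card ≤ (Finset.Ioc (s*s) (s*s+2*s)).card := by
    apply Finset.card_le_card_of_injOn (fun k : ℕ => a + d * (k:ℤ))
    · intro k hk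
      simp only [hT, Finset.coe_filter, Finset.mem_range, Set.mem_ofPred_eq] at hk
      simp only [Finset.coe_Ioc, Set.mem_Ioc]
      exact ⟨hk.2, by linarith [(hb k hk.1).2]⟩
    · intro k _ l _ hkl
      simp only [add_right_inj, mul_eq_mul_left_iff, Nat.cast_inj] at hkl
      rcases hkl with h | h
      · exact h
      · omega
  rw [Int.card_Ioc] at hc
  have hc' : (T.card : ℝ) ≤ 2 * s := by
    have : (T.card : ℤ) ≤ 2*s := by omega
    exact_mod_cast this
  have B : ‖∑ k ∈ T, hh ((a - 1 + d * (k:ℤ))/s)‖ ≤ T.card * 1 :=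
    norm_sum_le_card 1 (fun k _ => hh_norm _)
  have E : ∑ k ∈ Finset.range L, f (a + d * (k:ℤ)) =
      ∑ k ∈ Finset.range L, hh ((a - 1 + d * (k:ℤ))/s) - ∑ k ∈ T, hh ((a - 1 + d * (k:ℤ))/s) := by
    rw [hT, Finset.sum_filter, ← Finset.sum_sub_distrib]
    apply Finset.sum_congr rfl
    intro k hk
    have := hb k (Finset.mem_range.1 hk)
    split_ifs with h
    · rw [h2 _ h]; ring
    · rw [h1 _ this.1 (by omega), sub_zero]; congr 2; ring
  rw [E]
  have : (1:ℝ) ≤ s := by exact_mod_cast hs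
  have := norm_sub_le (∑ k ∈ Finset.range L, hh ((a - 1 + d * (k:ℤ))/s)) (∑ k ∈ T, hh ((a - 1 + d * (k:ℤ))/s))
  linarith

lemma ap_all (N s : ℤ) (hs : 0 < s) (hN : N ≤ s*s+2*s) (f : ℤ → ℂ)
    (h1 : ∀ x, 1 ≤ x → x ≤ s*s → f x = hh ((x-1)/s)) (h2 : ∀ x, s*s < x → f x = 0)
    (a d : ℤ) (L : ℕ) (hb : ∀ k < L, 1 ≤ a + d * (k:ℤ) ∧ a + d * k ≤ N) :
    ‖∑ x ∈ (Finset.range L).image (fun k : ℕ => a + d * (k : ℤ)), f x‖ ≤ 7 * s := by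
  have hs1 : (1:ℝ) ≤ s := by exact_mod_cast hs
  by_cases hd0 : d = 0
  · subst hd0
    rcases Nat.eq_zero_or_pos L with rfl | hL
    · simp; linarith
    · have : (Finset.range L).image (fun k : ℕ => a + 0 * (k : ℤ)) = {a} := by
        simp only [zero_mul, add_zero]
        exact Finset.image_const ⟨0, by simpa using hL⟩ a
      rw [this, Finset.sum_singleton]
      have := hb 0 hL
      simp only [zero_mul, add_zero] at this
      have : ‖f a‖ ≤ 1 := by
        rcases le_or_gt a (s*s) with h | h
        · rw [h1 a this.1 h]; exact hh_norm _
        · rw [h2 a h]; simp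
      linarith
  rw [Finset.sum_image (by
    intro k _ l _ h
    simpa [hd0] using h)]
  rcases lt_or_gt_of_ne hd0 with hd | hd
  · rw [← Finset.sum_range_reflect]
    have := ap_pos N s hs hN f h1 h2 (a + d * (L-1)) (-d) (by omega) L (by
      intro k hk
      have := hb (L-1-k) (by omega)
      rw [show ((L - 1 - k : ℕ) : ℤ) = L - 1 - k by omega] at this
      rw [show a + d * ((L:ℤ)-1) + -d * k = a + d * (L-1-k) by ring]
      exact this)
    convert this using 2
    apply Finset.sum_congr rfl
    intro k hk
    rw [Finset.mem_range] at hk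
    rw [show ((L - 1 - k : ℕ) : ℤ) = L - 1 - k by omega]
    congr 1; ring
  · exact ap_pos N s hs hN f h1 h2 a d hd L hb

/-- A convex set in a residue class is an AP. -/
lemma is_ap (S : Finset ℤ) (q : ℕ) (hq : 0 < q) (hmod : ∀ x ∈ S, ∀ y ∈ S, x % (q:ℤ) = y % (q:ℤ))
    (hcv : ∀ x ∈ S, ∀ y ∈ S, ∀ z, x ≤ z → z ≤ y → z % (q:ℤ) = x % (q:ℤ) → z ∈ S) :
    ∃ (a : ℤ) (L : ℕ), S = (Finset.range L).image (fun k : ℕ => a + (q:ℤ) * (k : ℤ)) := by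
  rcases S.eq_empty_or_nonempty with rfl | hne
  · exact ⟨0, 0, by simp⟩
  have hq' : (0:ℤ) < q := by exact_mod_cast hq
  have ha := S.min'_mem hne
  have hb := S.max'_mem hne
  refine ⟨S.min' hne, ((S.max' hne - S.min' hne) / q).toNat + 1, ?_⟩
  have hab : 0 ≤ (S.max' hne - S.min' hne) / (q:ℤ) :=
    Int.ediv_nonneg (sub_nonneg.2 (S.min'_le _ hb)) hq'.le
  ext x
  simp only [Finset.mem_image, Finset.mem_range]
  constructor
  · intro hx
    have hax := S.min'_le _ hx
    have hxb := S.le_max' _ hx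
    obtain ⟨t, ht⟩ := Int.ModEq.dvd (hmod _ ha _ hx : Int.ModEq q _ _)
    have ht0 : 0 ≤ t := by
      by_contra h
      push Not at h
      have := mul_neg_of_pos_of_neg hq' h
      linarith
    have htl : t ≤ (S.max' hne - S.min' hne) / (q:ℤ) := by
      rw [Int.le_ediv_iff_mul_le hq']; linarith
    exact ⟨t.toNat, by omega, by rw [Int.toNat_of_nonneg ht0]; linarith⟩
  · rintro ⟨k, hk, rfl⟩
    have hk' : (k:ℤ) ≤ (S.max' hne - S.min' hne) / (q:ℤ) := by omega
    rw [Int.le_ediv_iff_mul_le hq'] at hk'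
    refine hcv _ ha _ hb _ ?_ (by linarith) (by simp)
    have : 0 ≤ (q:ℤ) * k := by positivity
    linarith

lemma local_bound (N : ℕ) (hN : 0 < N) (f : ℤ → ℂ) (B : ℝ) (hB : 0 ≤ B)
    (hap : ∀ (a d : ℤ) (L : ℕ),
            (Finset.range L).image (fun k : ℕ => a + d * (k : ℤ)) ⊆
              Finset.Icc (1 : ℤ) (N : ℤ) →
            ‖∑ x ∈ (Finset.range L).image (fun k : ℕ => a + d * (k : ℤ)), f x‖ ≤ B)
    (δ : ℝ) (φ : ℤ → ℂ) (M : ℝ) (q : ℕ) (h0 : 0 < δ) (hδ : δ ≤ 1)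
    (hφ : ∀ x, ‖φ x‖ ≤ 1) (hloc : IsLocalFunction φ M q) (hM : δ * N ≤ M) (hq : 0 < q)
    (hqδ : (q : ℝ) ≤ δ⁻¹) :
    ‖∑ x ∈ Finset.Icc (1 : ℤ) (N : ℤ), f x * φ x‖ ≤ 3 * B / δ ^ 2 := by
  obtain ⟨r, hr⟩ := hloc
  have hN' : (0:ℝ) < N := by exact_mod_cast hN
  have hN1 : (1:ℝ) ≤ N := by exact_mod_cast hN
  have hq' : (0:ℤ) < q := by exact_mod_cast hq
  have hM0 : 0 < M := lt_of_lt_of_le (by positivity) hM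
  set g : ℤ → ℤ := fun x => ⌊((x : ℝ) - r) / M⌋ with hg
  have gmono : Monotone g := by
    intro x y hxy
    have : (x:ℝ) ≤ y := by exact_mod_cast hxy
    simp only [hg]
    gcongr
  have hmaps : ∀ x ∈ Finset.Icc (1:ℤ) N, (g x, x % (q:ℤ)) ∈
      Finset.Icc (g 1) (g N) ×ˢ Finset.Ico (0:ℤ) q := by
    intro x hx
    rw [Finset.mem_Icc] at hx
    rw [Finset.mem_product, Finset.mem_Icc, Finset.mem_Ico]
    exact ⟨⟨gmono hx.1, gmono hx.2⟩, Int.emod_nonneg _ hq'.ne', Int.emod_lt_of_pos _ hq'⟩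
  rw [← Finset.sum_fiberwise_of_maps_to hmaps]
  have hfib : ∀ p ∈ Finset.Icc (g 1) (g N) ×ˢ Finset.Ico (0:ℤ) q,
      ‖∑ x ∈ Finset.Icc (1:ℤ) N with (g x, x % (q:ℤ)) = p, f x * φ x‖ ≤ B := by
    rintro ⟨i, c⟩ _
    set S := (Finset.Icc (1:ℤ) N).filter (fun x => (g x, x % (q:ℤ)) = (i, c)) with hS
    have hmem : ∀ x, x ∈ S ↔ (1 ≤ x ∧ x ≤ N) ∧ g x = i ∧ x % (q:ℤ) = c := by
      intro x; simp [hS]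
    rcases S.eq_empty_or_nonempty with he | ⟨x0, hx0⟩
    · rw [he]; simpa using hB
    have hx0' := (hmem x0).1 hx0
    have : ∑ x ∈ S, f x * φ x = (∑ x ∈ S, f x) * φ x0 := by
      rw [Finset.sum_mul]
      apply Finset.sum_congr rfl
      intro x hx
      have hx' := (hmem x).1 hx
      rw [hr x x0 (hx'.2.1.trans hx0'.2.1.symm) (hx'.2.2.trans hx0'.2.2.symm)]
    rw [this, norm_mul]
    obtain ⟨a, L, haL⟩ := is_ap S q hq
      (fun x hx y hy => ((hmem x).1 hx).2.2.trans ((hmem y).1 hy).2.2.symm)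
      (by
        intro x hx y hy z hxz hzy hz
        have hx' := (hmem x).1 hx
        have hy' := (hmem y).1 hy
        refine (hmem z).2 ⟨⟨by omega, by omega⟩, le_antisymm ?_ ?_, hz.trans hx'.2.2⟩
        · rw [← hy'.2.1]; exact gmono hzy
        · rw [← hx'.2.1]; exact gmono hxz)
    have h3 : ‖∑ x ∈ S, f x‖ ≤ B := by
      have := hap a q L (by rw [← haL]; exact Finset.filter_subset _ _)
      rwa [← haL] at this
    calc _ ≤ B * 1 := mul_le_mul h3 (hφ _) (norm_nonneg _) hB
      _ = B := mul_one _
  have hsum := norm_sum_le_of_le _ hfib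
  refine hsum.trans ?_
  rw [Finset.sum_const, Finset.card_product, Int.card_Icc, Int.card_Ico, nsmul_eq_mul]
  have hcard : ((g N + 1 - g 1).toNat : ℝ) ≤ 3 * δ⁻¹ := by
    have hle := gmono (show (1:ℤ) ≤ N by omega)
    have : (((g N + 1 - g 1).toNat : ℤ) : ℝ) = g N + 1 - g 1 := by
      rw [Int.toNat_of_nonneg (by omega)]; push_cast; ring
    rw [Int.cast_natCast] at this
    rw [this]
    have u1 : (g N : ℝ) ≤ ((N:ℝ) - r)/M := by simpa [hg] using Int.floor_le (((N:ℝ) - r)/M)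
    have u2 : ((1:ℝ) - r)/M < g 1 + 1 := by simpa [hg] using Int.lt_floor_add_one (((1:ℝ) - r)/M)
    have u3 : ((N:ℝ) - r)/M - (1-r)/M ≤ δ⁻¹ := by
      rw [← sub_div, div_le_iff₀ hM0]
      have : (N:ℝ) ≤ δ⁻¹ * M := by
        rw [inv_mul_eq_div, le_div_iff₀ h0]; linarith
      linarith
    have u4 : 1 ≤ δ⁻¹ := (one_le_inv₀ h0).2 hδ
    linarith
  have : ((((g N + 1 - g 1).toNat * ((q:ℤ) - 0).toNat : ℕ)) : ℝ) ≤ 3 * δ⁻¹ * δ⁻¹ := by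
    push_cast
    have : (((q:ℤ) - 0).toNat : ℝ) = q := by simp
    rw [this]
    gcongr
  calc _ ≤ 3 * δ⁻¹ * δ⁻¹ * B := by gcongr
    _ = _ := by field_simp

/-- **The obstruction example does not correlate with local functions.**
The function `f` is specified by `f(x₁ + (x₂ - 1)⌊√N⌋)` according to `x₂ mod 4` for
positive integers `x₁, x₂ ≤ √N`, and `f = 0` elsewhere.  A finite arithmetic
progression `P ⊆ [N]` is encoded as the image of `{0, …, L-1}` under `k ↦ a + dk`.
Since `f` is supported in `[N]`, `∑_{x ∈ ℤ} f(x)φ(x)` equals the finite sum over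
`x ∈ [N]`. -/
theorem obstruction_example_discorrelation :
    ∃ C : ℝ, 0 < C ∧
      ∀ (N : ℕ) (f : ℤ → ℂ),
        (∀ x₁ x₂ : ℤ, 1 ≤ x₁ → (x₁ : ℝ) ≤ Real.sqrt N → 1 ≤ x₂ → (x₂ : ℝ) ≤ Real.sqrt N →
          f (x₁ + (x₂ - 1) * (Nat.sqrt N : ℤ)) =
            if x₂ % 4 = 0 then 1 else if x₂ % 4 = 2 then -1 else 0) →
        (∀ x : ℤ, (¬ ∃ x₁ x₂ : ℤ, 1 ≤ x₁ ∧ (x₁ : ℝ) ≤ Real.sqrt N ∧ 1 ≤ x₂ ∧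
            (x₂ : ℝ) ≤ Real.sqrt N ∧ x = x₁ + (x₂ - 1) * (Nat.sqrt N : ℤ)) → f x = 0) →
        ((∀ (a d : ℤ) (L : ℕ),
            (Finset.range L).image (fun k : ℕ => a + d * (k : ℤ)) ⊆
              Finset.Icc (1 : ℤ) (N : ℤ) →
            ‖∑ x ∈ (Finset.range L).image (fun k : ℕ => a + d * (k : ℤ)), f x‖ ≤
              C * Real.sqrt N) ∧
          ∀ (δ : ℝ) (φ : ℤ → ℂ) (M : ℝ) (q : ℕ), 0 < δ → δ ≤ 1 →
            (∀ x, ‖φ x‖ ≤ 1) → IsLocalFunction φ M q → δ * N ≤ M → 0 < q →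
            (q : ℝ) ≤ δ⁻¹ →
            ‖∑ x ∈ Finset.Icc (1 : ℤ) (N : ℤ), f x * φ x‖ ≤
              C / δ ^ 2 * Real.sqrt N) := by
  refine ⟨21, by norm_num, ?_⟩
  intro N f hf1 hf2
  rcases Nat.eq_zero_or_pos N with rfl | hN
  · refine ⟨?_, ?_⟩
    · intro a d L h
      have : (Finset.range L).image (fun k : ℕ => a + d * (k : ℤ)) = ∅ := by
        simpa using h
      rw [this]; simp
    · intros; simp
  have hs : (0:ℤ) < Nat.sqrt N := by exact_mod_cast Nat.sqrt_pos.2 hN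
  have hiff : ∀ x : ℤ, (x:ℝ) ≤ Real.sqrt N ↔ x ≤ (Nat.sqrt N : ℤ) := by
    intro x
    rw [← Real.floor_real_sqrt_eq_nat_sqrt, Int.le_floor]
  have hsN : ((Nat.sqrt N : ℤ) : ℝ) ≤ Real.sqrt N := (hiff _).2 le_rfl
  simp only [hiff] at hf1 hf2
  have hNs : (N:ℤ) ≤ Nat.sqrt N * Nat.sqrt N + 2 * Nat.sqrt N := by
    have := Nat.sqrt_le_add N
    have h' : (N:ℤ) ≤ Nat.sqrt N * Nat.sqrt N + Nat.sqrt N + Nat.sqrt N := by exact_mod_cast this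
    linarith
  generalize (Nat.sqrt N : ℤ) = s at *
  have h1 : ∀ x, 1 ≤ x → x ≤ s*s → f x = hh ((x-1)/s) := by
    intro x hx hxs
    have e := Int.emod_add_mul_ediv (x-1) s
    have e1 := Int.emod_nonneg (x-1) hs.ne'
    have e2 := Int.emod_lt_of_pos (x-1) hs
    have e3 : 0 ≤ (x-1)/s := Int.ediv_nonneg (by omega) hs.le
    have e4 : (x-1)/s < s := Int.ediv_lt_of_lt_mul hs (by omega)
    have := hf1 ((x-1)%s+1) ((x-1)/s+1) (by omega) (by omega) (by omega) (by omega)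
    rw [show (x-1)%s+1 + ((x-1)/s+1-1)*s = x by linarith] at this
    rw [this]; rfl
  have h2 : ∀ x, s*s < x → f x = 0 := by
    intro x hx
    apply hf2
    rintro ⟨x1, x2, _, hx1, _, hx2, rfl⟩
    have := mul_le_mul_of_nonneg_right (show x2 - 1 ≤ s - 1 by omega) hs.le
    nlinarith
  have key : ∀ (a d : ℤ) (L : ℕ),
            (Finset.range L).image (fun k : ℕ => a + d * (k : ℤ)) ⊆
              Finset.Icc (1 : ℤ) (N : ℤ) →
            ‖∑ x ∈ (Finset.range L).image (fun k : ℕ => a + d * (k : ℤ)), f x‖ ≤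
              7 * Real.sqrt N := by
    intro a d L h
    have := ap_all N s hs hNs f h1 h2 a d L (by
      intro k hk
      exact Finset.mem_Icc.1 (h (Finset.mem_image.2 ⟨k, Finset.mem_range.2 hk, rfl⟩)))
    linarith
  refine ⟨?_, ?_⟩
  · intro a d L h
    have := key a d L h
    have := Real.sqrt_nonneg N
    linarith
  · intro δ φ M q h0 hδ hφ hloc hM hq hqδ
    have := local_bound N hN f (7 * Real.sqrt N) (by positivity) key δ φ M q h0 hδ hφ hloc hM hq hqδ
    refine this.trans (le_of_eq ?_)
    ring
end
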